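/- Let A = diag(a₁,a₂,a₃) with a₁a₂a₃ ≠ 0, A^∨ = A^{-1}·det A the cofactor matrix, and γ, M ∈ ℝ³ with (γ,γ)=1, (γ,M)=0. Define α = (γ,A^∨γ)·tr A^{-1} + 2(γ,Aγ) − 2 tr A, Ĥ = α(M,AM) − ((γ,A^∨γ) − α(γ,Aγ) + α tr A)·(M,M), and K̂ = ((γ,A^∨γ)(γ,AM) − ((γ,Aγ) − tr A)(γ,A^∨M))² · ((M,AM) + ((γ,Aγ) − tr A)(M,M)). Then Ĥ and K̂ Poisson-commute with respect to the e*(3) bracket {Mᵢ,Mⱼ} = ε_{ijk}M_k, {Mᵢ,γⱼ} = ε_{ijk}γ_k, {γᵢ,γⱼ} = 0 on the level set (γ,γ)=1, (γ,M)=0; i.e., the Poisson bracket {Ĥ, K̂} vanishes whenever (γ,γ)=1 and (γ,M)=0. -/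

import Mathlib

/-- Partial derivatives of a function F(γ₁,γ₂,γ₃,M₁,M₂,M₃) of six real variables. -/
noncomputable def pdG1 (F : ℝ → ℝ → ℝ → ℝ → ℝ → ℝ → ℝ) (g1 g2 g3 m1 m2 m3 : ℝ) : ℝ :=
  deriv (fun x => F x g2 g3 m1 m2 m3) g1

noncomputable def pdG2 (F : ℝ → ℝ → ℝ → ℝ → ℝ → ℝ → ℝ) (g1 g2 g3 m1 m2 m3 : ℝ) : ℝ :=
  deriv (fun x => F g1 x g3 m1 m2 m3) g2

noncomputable def pdG3 (F : ℝ → ℝ → ℝ → ℝ → ℝ → ℝ → ℝ) (g1 g2 g3 m1 m2 m3 : ℝ) : ℝ :=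
  deriv (fun x => F g1 g2 x m1 m2 m3) g3

noncomputable def pdM1 (F : ℝ → ℝ → ℝ → ℝ → ℝ → ℝ → ℝ) (g1 g2 g3 m1 m2 m3 : ℝ) : ℝ :=
  deriv (fun x => F g1 g2 g3 x m2 m3) m1

noncomputable def pdM2 (F : ℝ → ℝ → ℝ → ℝ → ℝ → ℝ → ℝ) (g1 g2 g3 m1 m2 m3 : ℝ) : ℝ :=
  deriv (fun x => F g1 g2 g3 m1 x m3) m2

noncomputable def pdM3 (F : ℝ → ℝ → ℝ → ℝ → ℝ → ℝ → ℝ) (g1 g2 g3 m1 m2 m3 : ℝ) : ℝ :=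
  deriv (fun x => F g1 g2 g3 m1 m2 x) m3

/-- The Lie–Poisson bracket on e*(3):
{F,G} = Σ ε_{ijk}(M_k ∂F/∂Mᵢ ∂G/∂Mⱼ + γ_k(∂F/∂Mᵢ ∂G/∂γⱼ − ∂G/∂Mᵢ ∂F/∂γⱼ)). -/
noncomputable def e3Bracket (F G : ℝ → ℝ → ℝ → ℝ → ℝ → ℝ → ℝ)
    (g1 g2 g3 m1 m2 m3 : ℝ) : ℝ :=
  m3 * (pdM1 F g1 g2 g3 m1 m2 m3 * pdM2 G g1 g2 g3 m1 m2 m3 -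
        pdM2 F g1 g2 g3 m1 m2 m3 * pdM1 G g1 g2 g3 m1 m2 m3) +
  m1 * (pdM2 F g1 g2 g3 m1 m2 m3 * pdM3 G g1 g2 g3 m1 m2 m3 -
        pdM3 F g1 g2 g3 m1 m2 m3 * pdM2 G g1 g2 g3 m1 m2 m3) +
  m2 * (pdM3 F g1 g2 g3 m1 m2 m3 * pdM1 G g1 g2 g3 m1 m2 m3 -
        pdM1 F g1 g2 g3 m1 m2 m3 * pdM3 G g1 g2 g3 m1 m2 m3) +
  g3 * ((pdM1 F g1 g2 g3 m1 m2 m3 * pdG2 G g1 g2 g3 m1 m2 m3 -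
         pdM1 G g1 g2 g3 m1 m2 m3 * pdG2 F g1 g2 g3 m1 m2 m3) -
        (pdM2 F g1 g2 g3 m1 m2 m3 * pdG1 G g1 g2 g3 m1 m2 m3 -
         pdM2 G g1 g2 g3 m1 m2 m3 * pdG1 F g1 g2 g3 m1 m2 m3)) +
  g1 * ((pdM2 F g1 g2 g3 m1 m2 m3 * pdG3 G g1 g2 g3 m1 m2 m3 -
         pdM2 G g1 g2 g3 m1 m2 m3 * pdG3 F g1 g2 g3 m1 m2 m3) -
        (pdM3 F g1 g2 g3 m1 m2 m3 * pdG2 G g1 g2 g3 m1 m2 m3 -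
         pdM3 G g1 g2 g3 m1 m2 m3 * pdG2 F g1 g2 g3 m1 m2 m3)) +
  g2 * ((pdM3 F g1 g2 g3 m1 m2 m3 * pdG1 G g1 g2 g3 m1 m2 m3 -
         pdM3 G g1 g2 g3 m1 m2 m3 * pdG1 F g1 g2 g3 m1 m2 m3) -
        (pdM1 F g1 g2 g3 m1 m2 m3 * pdG3 G g1 g2 g3 m1 m2 m3 -
         pdM1 G g1 g2 g3 m1 m2 m3 * pdG3 F g1 g2 g3 m1 m2 m3))

/-- α = (γ,A^∨γ)·tr A^{-1} + 2(γ,Aγ) − 2 tr A, for A = diag(a₁,a₂,a₃). -/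
noncomputable def alphaFun (a1 a2 a3 : ℝ) (g1 g2 g3 : ℝ) : ℝ :=
  (a2 * a3 * g1^2 + a1 * a3 * g2^2 + a1 * a2 * g3^2) * (1/a1 + 1/a2 + 1/a3) +
    2 * (a1 * g1^2 + a2 * g2^2 + a3 * g3^2) - 2 * (a1 + a2 + a3)

/-- Ĥ = α(M,AM) − ((γ,A^∨γ) − α(γ,Aγ) + α tr A)(M,M). -/
noncomputable def Hhat (a1 a2 a3 : ℝ) (g1 g2 g3 m1 m2 m3 : ℝ) : ℝ :=
  alphaFun a1 a2 a3 g1 g2 g3 * (a1 * m1^2 + a2 * m2^2 + a3 * m3^2) -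
    ((a2 * a3 * g1^2 + a1 * a3 * g2^2 + a1 * a2 * g3^2) -
      alphaFun a1 a2 a3 g1 g2 g3 * (a1 * g1^2 + a2 * g2^2 + a3 * g3^2) +
      alphaFun a1 a2 a3 g1 g2 g3 * (a1 + a2 + a3)) *
      (m1^2 + m2^2 + m3^2)

/-- K̂ = ((γ,A^∨γ)(γ,AM) − ((γ,Aγ)−trA)(γ,A^∨M))² · ((M,AM) + ((γ,Aγ)−trA)(M,M)). -/
noncomputable def Khat (a1 a2 a3 : ℝ) (g1 g2 g3 m1 m2 m3 : ℝ) : ℝ :=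
  ((a2 * a3 * g1^2 + a1 * a3 * g2^2 + a1 * a2 * g3^2) *
      (a1 * g1 * m1 + a2 * g2 * m2 + a3 * g3 * m3) -
    ((a1 * g1^2 + a2 * g2^2 + a3 * g3^2) - (a1 + a2 + a3)) *
      (a2 * a3 * g1 * m1 + a1 * a3 * g2 * m2 + a1 * a2 * g3 * m3))^2 *
  ((a1 * m1^2 + a2 * m2^2 + a3 * m3^2) +
    ((a1 * g1^2 + a2 * g2^2 + a3 * g3^2) - (a1 + a2 + a3)) * (m1^2 + m2^2 + m3^2))

/-- The bracket as a bilinear form on gradients. -/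
def brk (g1 g2 g3 m1 m2 m3 f1 f2 f3 f4 f5 f6 h1 h2 h3 h4 h5 h6 : ℝ) : ℝ :=
  m3*(f4*h5-f5*h4) + m1*(f5*h6-f6*h5) + m2*(f6*h4-f4*h6) +
  g3*((f4*h2-h4*f2)-(f5*h1-h5*f1)) + g1*((f5*h3-h5*f3)-(f6*h2-h6*f2)) +
  g2*((f6*h1-h6*f1)-(f4*h3-h4*f3))

def fG (a1 a2 a3 g1 g2 g3 : ℝ) : ℝ := a2 * a3 * g1^2 + a1 * a3 * g2^2 + a1 * a2 * g3^2

def fq (a1 a2 a3 g1 g2 g3 : ℝ) : ℝ := a1 * g1^2 + a2 * g2^2 + a3 * g3^2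

def fN (m1 m2 m3 : ℝ) : ℝ := m1^2 + m2^2 + m3^2

def fQ (a1 a2 a3 m1 m2 m3 : ℝ) : ℝ := a1 * m1^2 + a2 * m2^2 + a3 * m3^2

def fB (a1 a2 a3 g1 g2 g3 m1 m2 m3 : ℝ) : ℝ := a1 * g1 * m1 + a2 * g2 * m2 + a3 * g3 * m3

def fC (a1 a2 a3 g1 g2 g3 m1 m2 m3 : ℝ) : ℝ := a2 * a3 * g1 * m1 + a1 * a3 * g2 * m2 + a1 * a2 * g3 * m3

def brGN (a1 a2 a3 g1 g2 g3 m1 m2 m3 : ℝ) : ℝ :=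
  brk g1 g2 g3 m1 m2 m3
    (2*(a2*a3*g1)) (2*(a1*a3*g2)) (2*(a1*a2*g3)) (0) (0) (0)
    (0) (0) (0) (2*m1) (2*m2) (2*m3)

def brGQ (a1 a2 a3 g1 g2 g3 m1 m2 m3 : ℝ) : ℝ :=
  brk g1 g2 g3 m1 m2 m3
    (2*(a2*a3*g1)) (2*(a1*a3*g2)) (2*(a1*a2*g3)) (0) (0) (0)
    (0) (0) (0) (2*(a1*m1)) (2*(a2*m2)) (2*(a3*m3))

def brGB (a1 a2 a3 g1 g2 g3 m1 m2 m3 : ℝ) : ℝ :=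
  brk g1 g2 g3 m1 m2 m3
    (2*(a2*a3*g1)) (2*(a1*a3*g2)) (2*(a1*a2*g3)) (0) (0) (0)
    (a1*m1) (a2*m2) (a3*m3) (a1*g1) (a2*g2) (a3*g3)

def bruN (a1 a2 a3 g1 g2 g3 m1 m2 m3 : ℝ) : ℝ :=
  brk g1 g2 g3 m1 m2 m3
    (2*(a1*g1)) (2*(a2*g2)) (2*(a3*g3)) (0) (0) (0)
    (0) (0) (0) (2*m1) (2*m2) (2*m3)

def bruQ (a1 a2 a3 g1 g2 g3 m1 m2 m3 : ℝ) : ℝ :=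
  brk g1 g2 g3 m1 m2 m3
    (2*(a1*g1)) (2*(a2*g2)) (2*(a3*g3)) (0) (0) (0)
    (0) (0) (0) (2*(a1*m1)) (2*(a2*m2)) (2*(a3*m3))

def brNB (a1 a2 a3 g1 g2 g3 m1 m2 m3 : ℝ) : ℝ :=
  brk g1 g2 g3 m1 m2 m3
    (0) (0) (0) (2*m1) (2*m2) (2*m3)
    (a1*m1) (a2*m2) (a3*m3) (a1*g1) (a2*g2) (a3*g3)

def brNC (a1 a2 a3 g1 g2 g3 m1 m2 m3 : ℝ) : ℝ :=
  brk g1 g2 g3 m1 m2 m3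
    (0) (0) (0) (2*m1) (2*m2) (2*m3)
    (a2*a3*m1) (a1*a3*m2) (a1*a2*m3) (a2*a3*g1) (a1*a3*g2) (a1*a2*g3)

def brQB (a1 a2 a3 g1 g2 g3 m1 m2 m3 : ℝ) : ℝ :=
  brk g1 g2 g3 m1 m2 m3
    (0) (0) (0) (2*(a1*m1)) (2*(a2*m2)) (2*(a3*m3))
    (a1*m1) (a2*m2) (a3*m3) (a1*g1) (a2*g2) (a3*g3)

def brQC (a1 a2 a3 g1 g2 g3 m1 m2 m3 : ℝ) : ℝ :=
  brk g1 g2 g3 m1 m2 m3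
    (0) (0) (0) (2*(a1*m1)) (2*(a2*m2)) (2*(a3*m3))
    (a2*a3*m1) (a1*a3*m2) (a1*a2*m3) (a2*a3*g1) (a1*a3*g2) (a1*a2*g3)

/-- Differential of the Hamiltonian in terms of differentials of the basic functions. -/
def dHf (t G u N Q dG du dN dQ : ℝ) : ℝ :=
  (t * dG + 2 * du) * (Q + u * N) + (t * G + 2 * u) * (dQ + u * dN + N * du) - dG * N - G * dN

/-- Differential of the quartic integral in terms of differentials of the basic functions. -/
def dKf (G u N Q B C dG du dN dQ dB dC : ℝ) : ℝ :=
  2 * (G * B - u * C) * (Q + u * N) * (G * dB + B * dG - u * dC - C * du) +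
    (G * B - u * C)^2 * (dQ + u * dN + N * du)

lemma deriv_aux (t T x dG du dN dQ dB dC : ℝ) (G q N Q B C : ℝ → ℝ)
    (hG : HasDerivAt G dG x) (hq : HasDerivAt q du x) (hN : HasDerivAt N dN x)
    (hQ : HasDerivAt Q dQ x) (hB : HasDerivAt B dB x) (hC : HasDerivAt C dC x) :
    deriv (fun y => (G y * t + 2 * q y - 2 * T) * Q y -
      (G y - (G y * t + 2 * q y - 2 * T) * q y + (G y * t + 2 * q y - 2 * T) * T) * N y) x =
      dHf t (G x) (q x - T) (N x) (Q x) dG du dN dQ ∧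
    deriv (fun y => (G y * B y - (q y - T) * C y)^2 * (Q y + (q y - T) * N y)) x =
      dKf (G x) (q x - T) (N x) (Q x) (B x) (C x) dG du dN dQ dB dC := by
  have hα : HasDerivAt (fun y => G y * t + 2 * q y - 2 * T) (dG * t + 2 * du) x :=
    ((hG.mul_const t).add (hq.const_mul 2)).sub_const _
  have h := (hα.mul hQ).sub (((hG.sub (hα.mul hq)).add (hα.mul_const T)).mul hN)
  have hu := hq.sub_const T
  have h' := (((hG.mul hB).sub (hu.mul hC)).pow 2).mul (hQ.add (hu.mul hN))
  refine ⟨(h.congr_deriv ?_).deriv, (h'.congr_deriv ?_).deriv⟩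
  · simp only [Pi.mul_apply, Pi.add_apply, Pi.sub_apply, dHf]
    ring
  · simp only [Pi.mul_apply, Pi.add_apply, Pi.sub_apply, Pi.pow_apply, dKf]
    push_cast
    ring

lemma hd_of_quad (f : ℝ → ℝ) (x d c b e : ℝ) (h : ∀ y, f y = c*y^2+b*y+e) (hd : d = 2*c*x+b) :
    HasDerivAt f d x := by
  have hf : f = fun y => c*y^2+b*y+e := funext h
  have h1 := ((((hasDerivAt_id x).pow 2).const_mul c).add ((hasDerivAt_id x).const_mul b)).add_const e
  rw [hf, hd]
  refine h1.congr_deriv ?_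
  simp
  ring

/-- Algebra of the base brackets. -/
lemma final_alg (t d X G u N Q B C GN GQ W uN uQ NB NC QB QC : ℝ)
    (F1 : GQ + u*GN - G*uN = 0) (F2 : uQ = -GN)
    (I1 : G*QB - B*GQ - u*QC + C*uQ + u*(G*NB - B*GN - u*NC + C*uN) + N*u*W
        + (Q+u*N)*W + (G*B-u*C)*uN/2 = 2*d*X)
    (I2 : G*(N*W + (G*NB - B*GN - u*NC + C*uN)) + (G*B-u*C)*GN = 2*d*(t*G+2*u)*X) :
    2*(Q+u*N)*((Q+u*N)*(t*(G*W)+2*(u*W)) + (t*G+2*u)*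
        (G*QB - B*GQ - u*QC + C*uQ + u*(G*NB - B*GN - u*NC + C*uN) + N*u*W)
        - N*(G*W) - G*(G*NB - B*GN - u*NC + C*uN)) +
    (G*B-u*C)*((Q+u*N)*(t*(GQ+u*GN)+2*(uQ+u*uN)) - N*(GQ+u*GN) - G*(N*(-uN))) = 0 := by
  linear_combination 2*(Q+u*N)*((t*G+2*u)*I1 - I2) + (G*B-u*C)*((Q+u*N)*t - N)*F1
    + 2*(G*B-u*C)*(Q+u*N)*F2

/-- The three identities valid on the level set, in homogeneous form. -/
lemma core_F1 (g1 g2 g3 v1 v2 v3 a1 a2 a3 m1 m2 m3 r G u N Q B C : ℝ)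
    (hr : r = g1^2+g2^2+g3^2) (h1 : m1 = g2*v3-g3*v2) (h2 : m2 = g3*v1-g1*v3)
    (h3 : m3 = g1*v2-g2*v1) (hG : G = fG a1 a2 a3 g1 g2 g3)
    (hu : u = fq a1 a2 a3 g1 g2 g3 - (a1+a2+a3)*r)
    (hN : N = fN m1 m2 m3) (hQ : Q = fQ a1 a2 a3 m1 m2 m3)
    (hB : B = fB a1 a2 a3 g1 g2 g3 m1 m2 m3) (hC : C = fC a1 a2 a3 g1 g2 g3 m1 m2 m3) :
    r*brGQ a1 a2 a3 g1 g2 g3 m1 m2 m3 + u*brGN a1 a2 a3 g1 g2 g3 m1 m2 m3 - G*bruN a1 a2 a3 g1 g2 g3 m1 m2 m3 = 0 ∧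
    r*(G*brQB a1 a2 a3 g1 g2 g3 m1 m2 m3 - B*brGQ a1 a2 a3 g1 g2 g3 m1 m2 m3 - u*brQC a1 a2 a3 g1 g2 g3 m1 m2 m3 + C*bruQ a1 a2 a3 g1 g2 g3 m1 m2 m3)
      + u*(G*brNB a1 a2 a3 g1 g2 g3 m1 m2 m3 - B*brGN a1 a2 a3 g1 g2 g3 m1 m2 m3 - u*brNC a1 a2 a3 g1 g2 g3 m1 m2 m3 + C*bruN a1 a2 a3 g1 g2 g3 m1 m2 m3)
      + N*u*brGB a1 a2 a3 g1 g2 g3 m1 m2 m3 + (r*Q+u*N)*brGB a1 a2 a3 g1 g2 g3 m1 m2 m3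
      + (G*B-u*C)*bruN a1 a2 a3 g1 g2 g3 m1 m2 m3/2 = 2*(a1*a2*a3)*(r^2*(a1*m1*(g2*m3-g3*m2)+a2*m2*(g3*m1-g1*m3)+a3*m3*(g1*m2-g2*m1))) ∧
    G*(N*brGB a1 a2 a3 g1 g2 g3 m1 m2 m3 + (G*brNB a1 a2 a3 g1 g2 g3 m1 m2 m3 - B*brGN a1 a2 a3 g1 g2 g3 m1 m2 m3 - u*brNC a1 a2 a3 g1 g2 g3 m1 m2 m3 + C*bruN a1 a2 a3 g1 g2 g3 m1 m2 m3)) + (G*B-u*C)*brGN a1 a2 a3 g1 g2 g3 m1 m2 m3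
      = 2*((a1*a2+a1*a3+a2*a3)*G+2*(a1*a2*a3)*u)*(r*(a1*m1*(g2*m3-g3*m2)+a2*m2*(g3*m1-g1*m3)+a3*m3*(g1*m2-g2*m1))) := by
  subst hG hu hN hQ hB hC hr h1 h2 h3
  simp only [fG, fq, fN, fQ, fB, fC, brGN, brGQ, brGB, bruN, bruQ, brNB, brNC, brQB, brQC, brk]
  refine ⟨?_, ?_, ?_⟩ <;> ring

set_option maxHeartbeats 4000000 in
/-- The new integrable geodesic flow on S² with quartic integral:
Ĥ and K̂ Poisson-commute on the level set (γ,γ)=1, (γ,M)=0. -/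
theorem stmt_19 (a1 a2 a3 : ℝ) (ha : a1 * a2 * a3 ≠ 0)
    (g1 g2 g3 m1 m2 m3 : ℝ)
    (hγ : g1^2 + g2^2 + g3^2 = 1)
    (hortho : g1 * m1 + g2 * m2 + g3 * m3 = 0) :
    e3Bracket (Hhat a1 a2 a3) (Khat a1 a2 a3) g1 g2 g3 m1 m2 m3 = 0 := by
  obtain ⟨t, ht0⟩ : ∃ t, t = 1/a1 + 1/a2 + 1/a3 := ⟨_, rfl⟩
  obtain ⟨G, hG⟩ : ∃ G, G = fG a1 a2 a3 g1 g2 g3 := ⟨_, rfl⟩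
  obtain ⟨u, hu⟩ : ∃ u, u = fq a1 a2 a3 g1 g2 g3 - (a1 + a2 + a3) := ⟨_, rfl⟩
  obtain ⟨N, hN⟩ : ∃ N, N = fN m1 m2 m3 := ⟨_, rfl⟩
  obtain ⟨Q, hQ⟩ : ∃ Q, Q = fQ a1 a2 a3 m1 m2 m3 := ⟨_, rfl⟩
  obtain ⟨B, hB⟩ : ∃ B, B = fB a1 a2 a3 g1 g2 g3 m1 m2 m3 := ⟨_, rfl⟩
  obtain ⟨C, hC⟩ : ∃ C, C = fC a1 a2 a3 g1 g2 g3 m1 m2 m3 := ⟨_, rfl⟩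
  have h1 : pdG1 (Hhat a1 a2 a3) g1 g2 g3 m1 m2 m3 = dHf t G u N Q (2*(a2*a3*g1)) (2*(a1*g1)) (0) (0) ∧
      pdG1 (Khat a1 a2 a3) g1 g2 g3 m1 m2 m3 = dKf G u N Q B C (2*(a2*a3*g1)) (2*(a1*g1)) (0) (0) (a1*m1) (a2*a3*m1) := by
    subst ht0 hG hu hN hQ hB hC
    exact deriv_aux (1/a1 + 1/a2 + 1/a3) (a1 + a2 + a3) g1 _ _ _ _ _ _
      (fun y => fG a1 a2 a3 y g2 g3) (fun y => fq a1 a2 a3 y g2 g3) (fun _ => fN m1 m2 m3) (fun _ => fQ a1 a2 a3 m1 m2 m3) (fun y => fB a1 a2 a3 y g2 g3 m1 m2 m3) (fun y => fC a1 a2 a3 y g2 g3 m1 m2 m3)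
      (hd_of_quad _ _ _ (a2 * a3) (0) (a1 * a3 * g2^2 + a1 * a2 * g3^2) (fun y => by unfold fG; ring) (by ring))
      (hd_of_quad _ _ _ (a1) (0) (a2 * g2^2 + a3 * g3^2) (fun y => by unfold fq; ring) (by ring))
      (hasDerivAt_const _ _)
      (hasDerivAt_const _ _)
      (hd_of_quad _ _ _ (0) (a1*m1) (a2 * g2 * m2 + a3 * g3 * m3) (fun y => by unfold fB; ring) (by ring))
      (hd_of_quad _ _ _ (0) (a2*a3*m1) (a1 * a3 * g2 * m2 + a1 * a2 * g3 * m3) (fun y => by unfold fC; ring) (by ring))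
  have h2 : pdG2 (Hhat a1 a2 a3) g1 g2 g3 m1 m2 m3 = dHf t G u N Q (2*(a1*a3*g2)) (2*(a2*g2)) (0) (0) ∧
      pdG2 (Khat a1 a2 a3) g1 g2 g3 m1 m2 m3 = dKf G u N Q B C (2*(a1*a3*g2)) (2*(a2*g2)) (0) (0) (a2*m2) (a1*a3*m2) := by
    subst ht0 hG hu hN hQ hB hC
    exact deriv_aux (1/a1 + 1/a2 + 1/a3) (a1 + a2 + a3) g2 _ _ _ _ _ _
      (fun y => fG a1 a2 a3 g1 y g3) (fun y => fq a1 a2 a3 g1 y g3) (fun _ => fN m1 m2 m3) (fun _ => fQ a1 a2 a3 m1 m2 m3) (fun y => fB a1 a2 a3 g1 y g3 m1 m2 m3) (fun y => fC a1 a2 a3 g1 y g3 m1 m2 m3)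
      (hd_of_quad _ _ _ (a1 * a3) (0) (a2 * a3 * g1^2 + a1 * a2 * g3^2) (fun y => by unfold fG; ring) (by ring))
      (hd_of_quad _ _ _ (a2) (0) (a1 * g1^2 + a3 * g3^2) (fun y => by unfold fq; ring) (by ring))
      (hasDerivAt_const _ _)
      (hasDerivAt_const _ _)
      (hd_of_quad _ _ _ (0) (a2*m2) (a1 * g1 * m1 + a3 * g3 * m3) (fun y => by unfold fB; ring) (by ring))
      (hd_of_quad _ _ _ (0) (a1*a3*m2) (a2 * a3 * g1 * m1 + a1 * a2 * g3 * m3) (fun y => by unfold fC; ring) (by ring))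
  have h3 : pdG3 (Hhat a1 a2 a3) g1 g2 g3 m1 m2 m3 = dHf t G u N Q (2*(a1*a2*g3)) (2*(a3*g3)) (0) (0) ∧
      pdG3 (Khat a1 a2 a3) g1 g2 g3 m1 m2 m3 = dKf G u N Q B C (2*(a1*a2*g3)) (2*(a3*g3)) (0) (0) (a3*m3) (a1*a2*m3) := by
    subst ht0 hG hu hN hQ hB hC
    exact deriv_aux (1/a1 + 1/a2 + 1/a3) (a1 + a2 + a3) g3 _ _ _ _ _ _
      (fun y => fG a1 a2 a3 g1 g2 y) (fun y => fq a1 a2 a3 g1 g2 y) (fun _ => fN m1 m2 m3) (fun _ => fQ a1 a2 a3 m1 m2 m3) (fun y => fB a1 a2 a3 g1 g2 y m1 m2 m3) (fun y => fC a1 a2 a3 g1 g2 y m1 m2 m3)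
      (hd_of_quad _ _ _ (a1 * a2) (0) (a2 * a3 * g1^2 + a1 * a3 * g2^2) (fun y => by unfold fG; ring) (by ring))
      (hd_of_quad _ _ _ (a3) (0) (a1 * g1^2 + a2 * g2^2) (fun y => by unfold fq; ring) (by ring))
      (hasDerivAt_const _ _)
      (hasDerivAt_const _ _)
      (hd_of_quad _ _ _ (0) (a3*m3) (a1 * g1 * m1 + a2 * g2 * m2) (fun y => by unfold fB; ring) (by ring))
      (hd_of_quad _ _ _ (0) (a1*a2*m3) (a2 * a3 * g1 * m1 + a1 * a3 * g2 * m2) (fun y => by unfold fC; ring) (by ring))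
  have h4 : pdM1 (Hhat a1 a2 a3) g1 g2 g3 m1 m2 m3 = dHf t G u N Q (0) (0) (2*m1) (2*(a1*m1)) ∧
      pdM1 (Khat a1 a2 a3) g1 g2 g3 m1 m2 m3 = dKf G u N Q B C (0) (0) (2*m1) (2*(a1*m1)) (a1*g1) (a2*a3*g1) := by
    subst ht0 hG hu hN hQ hB hC
    exact deriv_aux (1/a1 + 1/a2 + 1/a3) (a1 + a2 + a3) m1 _ _ _ _ _ _
      (fun _ => fG a1 a2 a3 g1 g2 g3) (fun _ => fq a1 a2 a3 g1 g2 g3) (fun y => fN y m2 m3) (fun y => fQ a1 a2 a3 y m2 m3) (fun y => fB a1 a2 a3 g1 g2 g3 y m2 m3) (fun y => fC a1 a2 a3 g1 g2 g3 y m2 m3)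
      (hasDerivAt_const _ _)
      (hasDerivAt_const _ _)
      (hd_of_quad _ _ _ (1) (0) (m2^2 + m3^2) (fun y => by unfold fN; ring) (by ring))
      (hd_of_quad _ _ _ (a1) (0) (a2 * m2^2 + a3 * m3^2) (fun y => by unfold fQ; ring) (by ring))
      (hd_of_quad _ _ _ (0) (a1*g1) (a2 * g2 * m2 + a3 * g3 * m3) (fun y => by unfold fB; ring) (by ring))
      (hd_of_quad _ _ _ (0) (a2*a3*g1) (a1 * a3 * g2 * m2 + a1 * a2 * g3 * m3) (fun y => by unfold fC; ring) (by ring))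
  have h5 : pdM2 (Hhat a1 a2 a3) g1 g2 g3 m1 m2 m3 = dHf t G u N Q (0) (0) (2*m2) (2*(a2*m2)) ∧
      pdM2 (Khat a1 a2 a3) g1 g2 g3 m1 m2 m3 = dKf G u N Q B C (0) (0) (2*m2) (2*(a2*m2)) (a2*g2) (a1*a3*g2) := by
    subst ht0 hG hu hN hQ hB hC
    exact deriv_aux (1/a1 + 1/a2 + 1/a3) (a1 + a2 + a3) m2 _ _ _ _ _ _
      (fun _ => fG a1 a2 a3 g1 g2 g3) (fun _ => fq a1 a2 a3 g1 g2 g3) (fun y => fN m1 y m3) (fun y => fQ a1 a2 a3 m1 y m3) (fun y => fB a1 a2 a3 g1 g2 g3 m1 y m3) (fun y => fC a1 a2 a3 g1 g2 g3 m1 y m3)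
      (hasDerivAt_const _ _)
      (hasDerivAt_const _ _)
      (hd_of_quad _ _ _ (1) (0) (m1^2 + m3^2) (fun y => by unfold fN; ring) (by ring))
      (hd_of_quad _ _ _ (a2) (0) (a1 * m1^2 + a3 * m3^2) (fun y => by unfold fQ; ring) (by ring))
      (hd_of_quad _ _ _ (0) (a2*g2) (a1 * g1 * m1 + a3 * g3 * m3) (fun y => by unfold fB; ring) (by ring))
      (hd_of_quad _ _ _ (0) (a1*a3*g2) (a2 * a3 * g1 * m1 + a1 * a2 * g3 * m3) (fun y => by unfold fC; ring) (by ring))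
  have h6 : pdM3 (Hhat a1 a2 a3) g1 g2 g3 m1 m2 m3 = dHf t G u N Q (0) (0) (2*m3) (2*(a3*m3)) ∧
      pdM3 (Khat a1 a2 a3) g1 g2 g3 m1 m2 m3 = dKf G u N Q B C (0) (0) (2*m3) (2*(a3*m3)) (a3*g3) (a1*a2*g3) := by
    subst ht0 hG hu hN hQ hB hC
    exact deriv_aux (1/a1 + 1/a2 + 1/a3) (a1 + a2 + a3) m3 _ _ _ _ _ _
      (fun _ => fG a1 a2 a3 g1 g2 g3) (fun _ => fq a1 a2 a3 g1 g2 g3) (fun y => fN m1 m2 y) (fun y => fQ a1 a2 a3 m1 m2 y) (fun y => fB a1 a2 a3 g1 g2 g3 m1 m2 y) (fun y => fC a1 a2 a3 g1 g2 g3 m1 m2 y)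
      (hasDerivAt_const _ _)
      (hasDerivAt_const _ _)
      (hd_of_quad _ _ _ (1) (0) (m1^2 + m2^2) (fun y => by unfold fN; ring) (by ring))
      (hd_of_quad _ _ _ (a3) (0) (a1 * m1^2 + a2 * m2^2) (fun y => by unfold fQ; ring) (by ring))
      (hd_of_quad _ _ _ (0) (a3*g3) (a1 * g1 * m1 + a2 * g2 * m2) (fun y => by unfold fB; ring) (by ring))
      (hd_of_quad _ _ _ (0) (a1*a2*g3) (a2 * a3 * g1 * m1 + a1 * a3 * g2 * m2) (fun y => by unfold fC; ring) (by ring))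
  obtain ⟨F1, I1, I2⟩ := core_F1 g1 g2 g3 (m2*g3-m3*g2) (m3*g1-m1*g3) (m1*g2-m2*g1)
    a1 a2 a3 m1 m2 m3 1 G u N Q B C hγ.symm
    (by linear_combination (-m1)*hγ + g1*hortho) (by linear_combination (-m2)*hγ + g2*hortho)
    (by linear_combination (-m3)*hγ + g3*hortho) hG (by rw [hu]; ring) hN hQ hB hC
  have F2 : bruQ a1 a2 a3 g1 g2 g3 m1 m2 m3 = -brGN a1 a2 a3 g1 g2 g3 m1 m2 m3 := by
    unfold bruQ brGN brk
    ring
  have ha1 : a1 ≠ 0 := fun h => ha (by rw [h]; ring)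
  have ha2 : a2 ≠ 0 := fun h => ha (by rw [h]; ring)
  have ha3 : a3 ≠ 0 := fun h => ha (by rw [h]; ring)
  have ht : (a1 * a2 * a3) * t = a1*a2+a1*a3+a2*a3 := by
    rw [ht0]
    field_simp
    ring
  have key := final_alg t (a1*a2*a3) (a1*m1*(g2*m3-g3*m2)+a2*m2*(g3*m1-g1*m3)+a3*m3*(g1*m2-g2*m1)) G u N Q B C
    (brGN a1 a2 a3 g1 g2 g3 m1 m2 m3)
    (brGQ a1 a2 a3 g1 g2 g3 m1 m2 m3)
    (brGB a1 a2 a3 g1 g2 g3 m1 m2 m3)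
    (bruN a1 a2 a3 g1 g2 g3 m1 m2 m3)
    (bruQ a1 a2 a3 g1 g2 g3 m1 m2 m3)
    (brNB a1 a2 a3 g1 g2 g3 m1 m2 m3)
    (brNC a1 a2 a3 g1 g2 g3 m1 m2 m3)
    (brQB a1 a2 a3 g1 g2 g3 m1 m2 m3)
    (brQC a1 a2 a3 g1 g2 g3 m1 m2 m3)
    (by linear_combination F1) F2 (by linear_combination I1)
    (by linear_combination I2 - 2 * G * (a1*m1*(g2*m3-g3*m2)+a2*m2*(g3*m1-g1*m3)+a3*m3*(g1*m2-g2*m1)) * ht)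
  unfold e3Bracket
  rw [h1.1, h1.2, h2.1, h2.2, h3.1, h3.2, h4.1, h4.2, h5.1, h5.2, h6.1, h6.2]
  clear h1 h2 h3 h4 h5 h6 F1 F2 I1 I2 ht ht0 hG hu hN hQ hB hC
  simp only [brGN, brGQ, brGB, bruN, bruQ, brNB, brNC, brQB, brQC, brk] at key
  unfold dHf dKf
  linear_combination (G * B - u * C) * key
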